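/- Let p > 2 and let ψ ∈ C²(K⁻) be a classical solution on the backward light-cone K⁻ of the transformed equation □ψ + (1/(p−2)²) [ (ũ − ṽ)/( (−ṽ)^{1/(p−2)} − (−ũ)^{1/(p−2)} ) ]^{p−1} ψ|ψ|^{p−1} = 0, where ũ, ṽ denote the null coordinates on K⁻ (ṽ < ũ < 0). Then the function φ := Ω · (ψ ∘ Φ) ∈ C²(K⁺) is a classical solution of the original equation □φ + φ|φ|^{p−1} = 0 on the forward light-cone K⁺. -/

import Mathlib

/-- Partial derivative in the time variable `t` of a function of `(t, r)`. -/
noncomputable def pdt (f : ℝ → ℝ → ℝ) (t r : ℝ) : ℝ := deriv (fun s => f s r) t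

/-- Partial derivative in the radial variable `r` of a function of `(t, r)`. -/
noncomputable def pdr (f : ℝ → ℝ → ℝ) (t r : ℝ) : ℝ := deriv (fun s => f t s) r

/-- Radial d'Alembertian `□f = ∂_t²f − ∂_r²f − (2/r)∂_r f` for `r > 0`. -/
noncomputable def dAlembert (f : ℝ → ℝ → ℝ) (t r : ℝ) : ℝ :=
  pdt (pdt f) t r - pdr (pdr f) t r - (2 / r) * pdr f t r

/-- Time coordinate of `Φ(t,r)`, where in null coordinates `u = t + r`,
`v = t − r` the map is `Φ(u,v) = (−u^{−(p−2)}, −v^{−(p−2)})`. -/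
noncomputable def PhiT (p t r : ℝ) : ℝ :=
  (-(t + r) ^ (-(p - 2)) + -(t - r) ^ (-(p - 2))) / 2

/-- Radial coordinate of `Φ(t,r)`. -/
noncomputable def PhiR (p t r : ℝ) : ℝ :=
  (-(t + r) ^ (-(p - 2)) - -(t - r) ^ (-(p - 2))) / 2

/-- The conformal factor `Ω(u,v) = (v^{−(p−2)} − u^{−(p−2)})/(u − v)` written
in the coordinates `(t,r)`, with `u = t + r`, `v = t − r`. -/
noncomputable def Omega (p t r : ℝ) : ℝ :=
  ((t - r) ^ (-(p - 2)) - (t + r) ^ (-(p - 2))) / (2 * r)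

/-- Iterated derivative of a `C²` function along a family of curves `γ s`, the inner derivative
being taken at the point `δ s = γ s (m s)`, where the velocity of `γ s` is constant in `s`. -/
theorem hasDerivAt_deriv_comp_curves {E : Type*} [NormedAddCommGroup E] [NormedSpace ℝ E]
    {H : E → ℝ} {γ : ℝ → ℝ → E} {m : ℝ → ℝ} {δ : ℝ → E} {a b : E} {s₀ : ℝ}
    (hH : ContDiffAt ℝ 2 H (δ s₀)) (hγ : ∀ᶠ s in nhds s₀, HasDerivAt (γ s) b (m s))
    (hm : ∀ s, γ s (m s) = δ s) (hδ : HasDerivAt δ a s₀) :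
    HasDerivAt (fun s => deriv (fun τ => H (γ s τ)) (m s))
      (fderiv ℝ (fderiv ℝ H) (δ s₀) a b) s₀ := by
  have h2 : HasFDerivAt (fderiv ℝ H) (fderiv ℝ (fderiv ℝ H) (δ s₀)) (δ s₀) :=
    ((hH.fderiv_right (m := 1) (by norm_num)).differentiableAt (by norm_num)).hasFDerivAt
  have h3 : HasDerivAt (fun s => fderiv ℝ H (δ s) b) (fderiv ℝ (fderiv ℝ H) (δ s₀) a b) s₀ := by
    simpa using (h2.comp_hasDerivAt s₀ hδ).clm_apply (hasDerivAt_const s₀ b)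
  refine h3.congr_of_eventuallyEq ?_
  have hev := hδ.continuousAt.eventually (hH.eventually (by simp))
  filter_upwards [hγ, hev] with s hs hHs
  have h4 : HasFDerivAt H (fderiv ℝ H (γ s (m s))) (γ s (m s)) := by
    rw [hm]
    exact (hHs.differentiableAt (by norm_num)).hasFDerivAt
  rw [← hm s]
  exact (h4.comp_hasDerivAt (m s) hs).deriv

theorem mul_dAlembert_eq_fderiv_fderiv {f : ℝ → ℝ → ℝ} {t r : ℝ}
    (hf : ContDiffAt ℝ 2 (fun q : ℝ × ℝ => f q.1 q.2) (t, r)) (hr : r ≠ 0) :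
    r * dAlembert f t r =
      fderiv ℝ (fderiv ℝ (fun q : ℝ × ℝ => q.2 * f q.1 q.2)) (t, r) (1, 1) (1, -1) := by
  have hH : ContDiffAt ℝ 2 (fun q : ℝ × ℝ => q.2 * f q.1 q.2) (t, r) := contDiffAt_snd.mul hf
  have ht (s τ : ℝ) : HasDerivAt (fun x : ℝ => (x, s)) ((1, 0) : ℝ × ℝ) τ :=
    (hasDerivAt_id τ).prodMk (hasDerivAt_const τ s)
  have hx (s τ : ℝ) : HasDerivAt (fun x : ℝ => (s, x)) ((0, 1) : ℝ × ℝ) τ :=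
    (hasDerivAt_const τ s).prodMk (hasDerivAt_id τ)
  have htt := (hasDerivAt_deriv_comp_curves (γ := fun _ τ => (τ, r)) (m := fun s => s)
    (s₀ := t) hH (.of_forall fun s => ht r s) (fun _ => rfl) (ht r t)).deriv
  have hrr := (hasDerivAt_deriv_comp_curves (γ := fun _ τ => (t, τ)) (m := fun s => s)
    (s₀ := r) hH (.of_forall fun s => hx t s) (fun _ => rfl) (hx t r)).deriv
  have hfrr := (hasDerivAt_deriv_comp_curves (γ := fun _ τ => (t, τ)) (m := fun s => s)
    (s₀ := r) hf (.of_forall fun s => hx t s) (fun _ => rfl) (hx t r)).differentiableAt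
  have hfr : ∀ᶠ s in nhds r, HasDerivAt (fun x => f t x) (pdr f t s) s := by
    have hev := (hx t r).continuousAt.eventually (hf.eventually (by simp))
    filter_upwards [hev] with s hs
    exact ((hs.differentiableAt (by norm_num)).comp s
      (hx t s).differentiableAt).hasDerivAt
  have e1 : deriv (fun s => deriv (fun τ => r * f τ r) s) t = r * pdt (pdt f) t r := by
    simp only [deriv_const_mul_field', pdt]
  have e2 : deriv (fun s => deriv (fun τ => τ * f t τ) s) r
      = r * pdr (pdr f) t r + 2 * pdr f t r := by
    have h1 : (fun s => deriv (fun τ => τ * f t τ) s) =ᶠ[nhds r]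
        fun s => f t s + s * pdr f t s := by
      filter_upwards [hfr] with s hs
      simpa [Pi.mul_def] using ((hasDerivAt_id s).mul hs).deriv
    have h2 : HasDerivAt (fun s => pdr f t s) (pdr (pdr f) t r) r := hfrr.hasDerivAt
    have h3 : HasDerivAt (fun s => f t s + s * pdr f t s)
        (pdr f t r + (1 * pdr f t r + r * pdr (pdr f) t r)) r :=
      hfr.self_of_nhds.add ((hasDerivAt_id r).mul h2)
    rw [h1.deriv_eq, h3.deriv]
    ring
  have hsymm := (hH.isSymmSndFDerivAt (by simp)).eq (1, 0) (0, 1)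
  simp only at htt hrr
  rw [e1] at htt
  rw [e2] at hrr
  have ha : ((1, 1) : ℝ × ℝ) = (1, 0) + (0, 1) := by simp
  have hb : ((1, -1) : ℝ × ℝ) = (1, 0) - (0, 1) := by simp
  rw [ha, hb]
  simp only [map_add, map_sub, add_apply]
  rw [hsymm, ← htt, ← hrr, dAlembert]
  field_simp
  ring

/-- Mixed second derivative in null coordinates reparametrised by `α`. -/
theorem deriv_deriv_null_comp {H : ℝ × ℝ → ℝ} {α : ℝ → ℝ} {u v α₁ α₂ : ℝ}
    (hH : ContDiffAt ℝ 2 H ((α u + α v) / 2, (α u - α v) / 2))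
    (hu : HasDerivAt α α₁ u) (hv : HasDerivAt α α₂ v) :
    deriv (fun x => deriv (fun y => H ((α x + α y) / 2, (α x - α y) / 2)) v) u =
      α₁ * α₂ / 4 *
        fderiv ℝ (fderiv ℝ H) ((α u + α v) / 2, (α u - α v) / 2) (1, 1) (1, -1) := by
  have hγ (x : ℝ) : HasDerivAt (fun y => ((α x + α y) / 2, (α x - α y) / 2))
      ((α₂ / 2) • ((1, -1) : ℝ × ℝ)) v := by
    convert ((hv.const_add (α x)).div_const 2).prodMk ((hv.const_sub (α x)).div_const 2) using 1
    ext <;> simp; ring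
  have hδ : HasDerivAt (fun x => ((α x + α v) / 2, (α x - α v) / 2))
      ((α₁ / 2) • ((1, 1) : ℝ × ℝ)) u := by
    convert ((hu.add_const (α v)).div_const 2).prodMk ((hu.sub_const (α v)).div_const 2) using 1
    ext <;> simp
  rw [(hasDerivAt_deriv_comp_curves (m := fun _ => v)
    (γ := fun x y => ((α x + α y) / 2, (α x - α y) / 2))
    (δ := fun x => ((α x + α v) / 2, (α x - α v) / 2)) hH (.of_forall hγ) (fun _ => rfl) hδ).deriv]
  simp only [map_smul, smul_apply, smul_eq_mul]
  ring

theorem isOpen_forwardCone : IsOpen {q : ℝ × ℝ | 0 < q.2 ∧ q.2 < q.1} :=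
  (isOpen_lt continuous_const continuous_snd).inter (isOpen_lt continuous_snd continuous_fst)

theorem isOpen_backwardCone : IsOpen {q : ℝ × ℝ | 0 < q.2 ∧ q.2 < -q.1} :=
  (isOpen_lt continuous_const continuous_snd).inter
    (isOpen_lt continuous_snd continuous_fst.neg)

theorem mul_Omega (p t r : ℝ) : r * Omega p t r = PhiR p t r := by
  rcases eq_or_ne r 0 with rfl | hr
  · simp [PhiR]
  · rw [Omega, PhiR]
    field_simp
    ring

theorem PhiR_pos {p t r : ℝ} (hp : 2 < p) (hr : 0 < r) (hrt : r < t) : 0 < PhiR p t r := by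
  have := Real.rpow_lt_rpow_of_neg (x := t - r) (y := t + r) (z := -(p - 2))
    (by linarith) (by linarith) (by linarith)
  rw [PhiR]
  linarith

theorem PhiR_lt_neg_PhiT {p t r : ℝ} (hr : 0 < r) (hrt : r < t) : PhiR p t r < -PhiT p t r := by
  have := Real.rpow_pos_of_pos (x := t + r) (by linarith) (-(p - 2))
  rw [PhiR, PhiT]
  linarith

theorem contDiffOn_conformal {p : ℝ} (hp : 2 < p) {ψ : ℝ → ℝ → ℝ}
    (hψ : ContDiffOn ℝ 2 (fun q : ℝ × ℝ => ψ q.1 q.2) {q : ℝ × ℝ | 0 ≤ q.2 ∧ q.2 < -q.1}) :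
    ContDiffOn ℝ 2
      (fun q : ℝ × ℝ => Omega p q.1 q.2 * ψ (PhiT p q.1 q.2) (PhiR p q.1 q.2))
      {q : ℝ × ℝ | 0 < q.2 ∧ q.2 < q.1} := by
  have hu : ContDiffOn ℝ 2 (fun q : ℝ × ℝ => (q.1 + q.2) ^ (-(p - 2)))
      {q : ℝ × ℝ | 0 < q.2 ∧ q.2 < q.1} :=
    (contDiff_fst.add contDiff_snd).contDiffOn.rpow_const_of_ne
      fun q hq => (by linarith [hq.1, hq.2] : 0 < q.1 + q.2).ne'
  have hv : ContDiffOn ℝ 2 (fun q : ℝ × ℝ => (q.1 - q.2) ^ (-(p - 2)))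
      {q : ℝ × ℝ | 0 < q.2 ∧ q.2 < q.1} :=
    (contDiff_fst.sub contDiff_snd).contDiffOn.rpow_const_of_ne
      fun q hq => (sub_pos.2 hq.2).ne'
  have hΩ : ContDiffOn ℝ 2 (fun q : ℝ × ℝ => Omega p q.1 q.2)
      {q : ℝ × ℝ | 0 < q.2 ∧ q.2 < q.1} :=
    (hv.sub hu).div (contDiff_const.mul contDiff_snd).contDiffOn
      fun q hq => mul_ne_zero two_ne_zero hq.1.ne'
  have hT : ContDiffOn ℝ 2 (fun q : ℝ × ℝ => PhiT p q.1 q.2)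
      {q : ℝ × ℝ | 0 < q.2 ∧ q.2 < q.1} := (hu.neg.add hv.neg).div_const 2
  have hR : ContDiffOn ℝ 2 (fun q : ℝ × ℝ => PhiR p q.1 q.2)
      {q : ℝ × ℝ | 0 < q.2 ∧ q.2 < q.1} := (hu.neg.sub hv.neg).div_const 2
  exact hΩ.mul (hψ.comp (hT.prodMk hR)
    fun q hq => ⟨(PhiR_pos hp hq.1 hq.2).le, PhiR_lt_neg_PhiT hq.1 hq.2⟩)

/-- Conformal covariance of the radial d'Alembertian under `Φ`. -/
theorem dAlembert_conformal {p t r : ℝ} (hp : 2 < p) {ψ : ℝ → ℝ → ℝ}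
    (hψ : ContDiffOn ℝ 2 (fun q : ℝ × ℝ => ψ q.1 q.2) {q : ℝ × ℝ | 0 ≤ q.2 ∧ q.2 < -q.1})
    (hr : 0 < r) (hrt : r < t) :
    dAlembert (fun t' r' => Omega p t' r' * ψ (PhiT p t' r') (PhiR p t' r')) t r =
      (p - 2) ^ 2 * ((t + r) * (t - r)) ^ (-(p - 1)) * Omega p t r *
        dAlembert ψ (PhiT p t r) (PhiR p t r) := by
  have hu : 0 < t + r := by linarith
  have hv : 0 < t - r := by linarith
  have hφ : ContDiffAt ℝ 2
      (fun q : ℝ × ℝ => Omega p q.1 q.2 * ψ (PhiT p q.1 q.2) (PhiR p q.1 q.2)) (t, r) :=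
    (contDiffOn_conformal hp hψ).contDiffAt (isOpen_forwardCone.mem_nhds ⟨hr, hrt⟩)
  have hψ' : ContDiffAt ℝ 2 (fun q : ℝ × ℝ => ψ q.1 q.2) (PhiT p t r, PhiR p t r) :=
    hψ.contDiffAt (Filter.mem_of_superset (isOpen_backwardCone.mem_nhds
      ⟨PhiR_pos hp hr hrt, PhiR_lt_neg_PhiT hr hrt⟩) fun q hq => ⟨hq.1.le, hq.2⟩)
  have hα (x : ℝ) (hx : 0 < x) : HasDerivAt (fun x : ℝ => -x ^ (-(p - 2)))
      ((p - 2) * x ^ (-(p - 1))) x := by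
    refine (Real.hasDerivAt_rpow_const (p := -(p - 2)) (Or.inl hx.ne')).fun_neg.congr_deriv ?_
    rw [show -(p - 2) - 1 = -(p - 1) by ring]
    ring
  have hφ2 := mul_dAlembert_eq_fderiv_fderiv
    (f := fun t' r' => Omega p t' r' * ψ (PhiT p t' r') (PhiR p t' r')) hφ hr.ne'
  have hψ2 := mul_dAlembert_eq_fderiv_fderiv hψ' (PhiR_pos hp hr hrt).ne'
  have hpt : (t, r) = (((t + r) + (t - r)) / 2, ((t + r) - (t - r)) / 2) := by
    ext <;> simp
  have hL := deriv_deriv_null_comp (u := t + r) (v := t - r) (α := fun x => x)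
    (H := fun q : ℝ × ℝ => q.2 * (Omega p q.1 q.2 * ψ (PhiT p q.1 q.2) (PhiR p q.1 q.2)))
    (hpt ▸ contDiffAt_snd.mul hφ) (hasDerivAt_id _) (hasDerivAt_id _)
  have hR := deriv_deriv_null_comp (u := t + r) (v := t - r) (α := fun x => -x ^ (-(p - 2)))
    (H := fun q : ℝ × ℝ => q.2 * ψ q.1 q.2)
    (contDiffAt_snd.mul hψ') (hα _ hu) (hα _ hv)
  have hfun (x y : ℝ) :
      (x - y) / 2 * (Omega p ((x + y) / 2) ((x - y) / 2) *
        ψ (PhiT p ((x + y) / 2) ((x - y) / 2)) (PhiR p ((x + y) / 2) ((x - y) / 2))) =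
      (-x ^ (-(p - 2)) - -y ^ (-(p - 2))) / 2 *
        ψ ((-x ^ (-(p - 2)) + -y ^ (-(p - 2))) / 2) ((-x ^ (-(p - 2)) - -y ^ (-(p - 2))) / 2) := by
    rw [← mul_assoc, mul_Omega, PhiR, PhiT, show (x + y) / 2 + (x - y) / 2 = x by ring,
      show (x + y) / 2 - (x - y) / 2 = y by ring]
  simp only [hfun] at hL
  rw [hR, ← hpt, ← hφ2] at hL
  change _ * fderiv ℝ (fderiv ℝ fun q : ℝ × ℝ => q.2 * ψ q.1 q.2)
    (PhiT p t r, PhiR p t r) (1, 1) (1, -1) = _ at hL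
  rw [← hψ2] at hL
  rw [Real.mul_rpow hu.le hv.le]
  refine mul_left_cancel₀ hr.ne' ?_
  linear_combination -4 * hL - (p - 2) ^ 2 * (t + r) ^ (-(p - 1)) * (t - r) ^ (-(p - 1)) *
    dAlembert ψ (PhiT p t r) (PhiR p t r) * mul_Omega p t r

theorem bracket_comp_Phi {p t r : ℝ} (hp : 2 < p) (hr : 0 < r) (hrt : r < t) :
    ((PhiT p t r + PhiR p t r) - (PhiT p t r - PhiR p t r)) /
      ((-(PhiT p t r - PhiR p t r)) ^ (1 / (p - 2)) -
        (-(PhiT p t r + PhiR p t r)) ^ (1 / (p - 2))) =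
      (t + r) * (t - r) * Omega p t r := by
  have hu : 0 < t + r := by linarith
  have hv : 0 < t - r := by linarith
  have hp' : p - 2 ≠ 0 := by linarith
  have hinv (x : ℝ) (hx : 0 < x) : (x ^ (-(p - 2))) ^ (1 / (p - 2)) = x⁻¹ := by
    rw [← Real.rpow_mul hx.le, show -(p - 2) * (1 / (p - 2)) = -1 by field_simp,
      Real.rpow_neg_one]
  have h1 : -(PhiT p t r - PhiR p t r) = (t - r) ^ (-(p - 2)) := by rw [PhiT, PhiR]; ring
  have h2 : -(PhiT p t r + PhiR p t r) = (t + r) ^ (-(p - 2)) := by rw [PhiT, PhiR]; ring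
  have h3 : (t - r)⁻¹ - (t + r)⁻¹ = 2 * r / ((t + r) * (t - r)) := by
    field_simp
    ring
  rw [h1, h2, hinv _ hu, hinv _ hv, h3,
    show PhiT p t r + PhiR p t r - (PhiT p t r - PhiR p t r) = 2 * PhiR p t r by ring,
    ← mul_Omega]
  field_simp

/-- Conversely, if `ψ ∈ C²(K⁻)` solves the transformed
equation `□ψ + (1/(p−2)²)[(ũ−ṽ)/((−ṽ)^{1/(p−2)} − (−ũ)^{1/(p−2)})]^{p−1}
ψ|ψ|^{p−1} = 0` on the backward light-cone, then `φ = Ω·(ψ∘Φ)` is a `C²`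
classical solution of `□φ + φ|φ|^{p−1} = 0` on the forward light-cone
(in null coordinates `0 < v < u`). -/
theorem inverse_transformed_equation
    (p : ℝ) (hp2 : 2 < p)
    (ψ : ℝ → ℝ → ℝ)
    (hψreg : ContDiffOn ℝ 2 (fun q : ℝ × ℝ => ψ q.1 q.2)
      {q : ℝ × ℝ | 0 ≤ q.2 ∧ q.2 < -q.1})
    (hsol : ∀ t r : ℝ, 0 < r → r < -t →
      dAlembert ψ t r +
        (1 / (p - 2) ^ 2) *
          (((t + r) - (t - r)) /
            ((-(t - r)) ^ (1 / (p - 2)) - (-(t + r)) ^ (1 / (p - 2)))) ^ (p - 1) *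
          (ψ t r * |ψ t r| ^ (p - 1)) = 0) :
    ContDiffOn ℝ 2
      (fun q : ℝ × ℝ => Omega p q.1 q.2 * ψ (PhiT p q.1 q.2) (PhiR p q.1 q.2))
      {q : ℝ × ℝ | 0 < q.2 ∧ q.2 < q.1} ∧
    ∀ t r : ℝ, 0 < r → r < t →
      dAlembert (fun t' r' => Omega p t' r' * ψ (PhiT p t' r') (PhiR p t' r')) t r +
        (Omega p t r * ψ (PhiT p t r) (PhiR p t r)) *
          |Omega p t r * ψ (PhiT p t r) (PhiR p t r)| ^ (p - 1) = 0 := by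
  refine ⟨contDiffOn_conformal hp2 hψreg, fun t r hr hrt => ?_⟩
  have hw : 0 < (t + r) * (t - r) := mul_pos (by linarith) (by linarith)
  have hΩ : 0 < Omega p t r := by
    have h := PhiR_pos hp2 hr hrt
    rw [← mul_Omega] at h
    exact pos_of_mul_pos_right h hr.le
  have hp' : p - 2 ≠ 0 := by linarith
  have hs := hsol _ _ (PhiR_pos hp2 hr hrt) (PhiR_lt_neg_PhiT hr hrt)
  rw [bracket_comp_Phi hp2 hr hrt, Real.mul_rpow hw.le hΩ.le] at hs
  rw [dAlembert_conformal hp2 hψreg hr hrt, eq_neg_of_add_eq_zero_left hs, abs_mul,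
    abs_of_pos hΩ, Real.mul_rpow hΩ.le (abs_nonneg _), Real.rpow_neg hw.le]
  have := (Real.rpow_pos_of_pos hw (p - 1)).ne'
  field_simp
  ring
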